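/- Fix κ > 0, Δ > 0 and an initial condition (θ₀, p₀) ∈ [0,1]². For parameters θ_a, θ̂_a ∈ (0,1) with θ_a ≥ θ̂_a, let (θ(t), p(t)) and (θ̂(t), p̂(t)) denote the solutions of θ' = θ(1−θ)((1−p)(1−θ) − Δpθ), p' = κ p(1−p)((1−θ)² − (1−θ_a)²) with AI skill θ_a and θ̂_a respectively, both started at (θ₀, p₀). Then for all t ≥ 0, θ(t) ≤ θ̂(t) and p(t) ≥ p̂(t); i.e., the skill is non-increasing and the delegation level non-decreasing in the AI skill θ_a. -/

import Mathlib

open Set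

/-- The squared negative part is differentiable everywhere. -/
lemma hasDerivAt_min_zero_sq (x : ℝ) :
    HasDerivAt (fun y : ℝ => min y 0 ^ 2) (2 * min x 0) x := by
  rcases lt_trichotomy x 0 with hx | rfl | hx
  · have h : HasDerivAt (fun y : ℝ => y ^ 2) (2 * min x 0) x := by
      simpa [min_eq_left hx.le] using hasDerivAt_pow 2 x
    refine h.congr_of_eventuallyEq ?_
    filter_upwards [Iio_mem_nhds hx] with y hy
    rw [min_eq_left (le_of_lt hy)]
  · have h : (fun y : ℝ => min y 0 ^ 2) =O[nhds 0] fun y : ℝ => y ^ 2 := by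
      refine Asymptotics.IsBigO.of_bound 1 (Filter.Eventually.of_forall fun y => ?_)
      rcases le_total y 0 with hy | hy
      · simp [min_eq_left hy]
      · simp [min_eq_right hy]
        positivity
    rw [hasDerivAt_iff_isLittleO]
    simpa using h.trans_isLittleO (Asymptotics.isLittleO_pow_id one_lt_two)
  · have h : HasDerivAt (fun _ : ℝ => (0 : ℝ)) (2 * min x 0) x := by
      simpa [min_eq_right hx.le] using hasDerivAt_const x (0 : ℝ)
    refine h.congr_of_eventuallyEq ?_
    filter_upwards [Ioi_mem_nhds hx] with y hy
    simp [min_eq_right ((mem_Ioi.1 hy).le)]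

/-- Gronwall's inequality in the form used for comparison: a function with `W' ≤ K W` that is
nonpositive initially stays nonpositive. -/
lemma nonpos_of_deriv_le_mul {W W' : ℝ → ℝ} {K T : ℝ} (hT : 0 ≤ T)
    (hW : ∀ t ∈ Icc 0 T, HasDerivWithinAt W (W' t) (Ici 0) t)
    (hle : ∀ t ∈ Icc 0 T, W' t ≤ K * W t) (h0 : W 0 ≤ 0) : W T ≤ 0 := by
  have hd : ∀ t ∈ Icc 0 T, HasDerivWithinAt (fun s => Real.exp (-(K * s)) * W s)
      (Real.exp (-(K * t)) * (W' t - K * W t)) (Icc 0 T) t := by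
    intro t ht
    have he : HasDerivAt (fun s => Real.exp (-(K * s))) (Real.exp (-(K * t)) * -(K * 1)) t :=
      (((hasDerivAt_id t).const_mul K).neg).exp
    refine (he.hasDerivWithinAt.mul ((hW t ht).mono Icc_subset_Ici_self)).congr_deriv ?_
    ring
  have hanti : AntitoneOn (fun s => Real.exp (-(K * s)) * W s) (Icc 0 T) := by
    refine antitoneOn_of_hasDerivWithinAt_nonpos (convex_Icc 0 T)
      (fun t ht => (hd t ht).continuousWithinAt)
      (fun t ht => (hd t (interior_subset ht)).mono interior_subset) fun t ht => ?_
    exact mul_nonpos_of_nonneg_of_nonpos (Real.exp_nonneg _)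
      (sub_nonpos.2 (hle t (interior_subset ht)))
  have h := hanti (left_mem_Icc.2 hT) (right_mem_Icc.2 hT) hT
  simp only [mul_zero, neg_zero, Real.exp_zero, one_mul] at h
  exact nonpos_of_mul_nonpos_right (h.trans h0) (Real.exp_pos _)

/-- The energy estimate for the squared negative parts in a cooperative planar system. -/
lemma min_zero_energy_le {a b c d C u v u' v' : ℝ} (hb : 0 ≤ b) (hc : 0 ≤ c)
    (hC : |a| + b + c + |d| ≤ C) (hu : a * u + b * v ≤ u') (hv : c * u + d * v ≤ v') :
    2 * min u 0 * u' + 2 * min v 0 * v' ≤ 2 * C * (min u 0 ^ 2 + min v 0 ^ 2) := by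
  have hx0 : min u 0 ≤ 0 := min_le_right u 0
  have hy0 : min v 0 ≤ 0 := min_le_right v 0
  have hxu : min u 0 * u = min u 0 ^ 2 := by
    rcases le_total u 0 with h | h <;> simp [h, sq]
  have hyv : min v 0 * v = min v 0 ^ 2 := by
    rcases le_total v 0 with h | h <;> simp [h, sq]
  have hxle : min u 0 ≤ u := min_le_left u 0
  have hyle : min v 0 ≤ v := min_le_left v 0
  generalize min u 0 = x at *
  generalize min v 0 = y at *
  have h1 : x * u' ≤ a * x ^ 2 + b * (x * y) := by
    have h2 := mul_le_mul_of_nonpos_left hu hx0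
    have h3 := mul_le_mul_of_nonneg_left (mul_le_mul_of_nonpos_left hyle hx0) hb
    linear_combination h2 + h3 + a * hxu
  have h1' : y * v' ≤ c * (x * y) + d * y ^ 2 := by
    have h2 := mul_le_mul_of_nonpos_left hv hy0
    have h3 := mul_le_mul_of_nonneg_left (mul_le_mul_of_nonpos_left hxle hy0) hc
    linear_combination h2 + h3 + d * hyv
  have hxy : x * y ≤ x ^ 2 + y ^ 2 := by nlinarith [sq_nonneg (x - y), sq_nonneg x, sq_nonneg y]
  have ha := mul_le_mul_of_nonneg_right (le_abs_self a) (sq_nonneg x)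
  have hd := mul_le_mul_of_nonneg_right (le_abs_self d) (sq_nonneg y)
  have hbxy := mul_le_mul_of_nonneg_left hxy hb
  have hcxy := mul_le_mul_of_nonneg_left hxy hc
  have hay := mul_nonneg (abs_nonneg a) (sq_nonneg y)
  have hdx := mul_nonneg (abs_nonneg d) (sq_nonneg x)
  have hCxy := mul_le_mul_of_nonneg_right hC (add_nonneg (sq_nonneg x) (sq_nonneg y))
  linarith

/-- The nonnegative quadrant is forward invariant under cooperative planar linear differential
inequalities with continuous coefficients. -/
lemma nonneg_of_cooperative {a b c d u v u' v' : ℝ → ℝ}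
    (ha : ContinuousOn a (Ici 0)) (hb : ContinuousOn b (Ici 0))
    (hc : ContinuousOn c (Ici 0)) (hd : ContinuousOn d (Ici 0))
    (hb0 : ∀ t ∈ Ici (0 : ℝ), 0 ≤ b t) (hc0 : ∀ t ∈ Ici (0 : ℝ), 0 ≤ c t)
    (hu : ∀ t ∈ Ici (0 : ℝ), HasDerivWithinAt u (u' t) (Ici 0) t)
    (hv : ∀ t ∈ Ici (0 : ℝ), HasDerivWithinAt v (v' t) (Ici 0) t)
    (hu' : ∀ t ∈ Ici (0 : ℝ), a t * u t + b t * v t ≤ u' t)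
    (hv' : ∀ t ∈ Ici (0 : ℝ), c t * u t + d t * v t ≤ v' t)
    (hu0 : 0 ≤ u 0) (hv0 : 0 ≤ v 0) :
    ∀ t ∈ Ici (0 : ℝ), 0 ≤ u t ∧ 0 ≤ v t := by
  intro T hT
  obtain ⟨C, hC⟩ := isCompact_Icc.bddAbove_image
    ((((ha.abs.add hb).add hc).add hd.abs).mono (Icc_subset_Ici_self : Icc 0 T ⊆ Ici 0))
  have hW : min (u T) 0 ^ 2 + min (v T) 0 ^ 2 ≤ 0 := by
    refine nonpos_of_deriv_le_mul (W := fun t => min (u t) 0 ^ 2 + min (v t) 0 ^ 2)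
      (W' := fun t => 2 * min (u t) 0 * u' t + 2 * min (v t) 0 * v' t) (K := 2 * C) hT
      (fun t ht => ?_) (fun t ht => ?_) (by simp [hu0, hv0])
    · exact ((hasDerivAt_min_zero_sq (u t)).comp_hasDerivWithinAt t (hu t ht.1)).add
        ((hasDerivAt_min_zero_sq (v t)).comp_hasDerivWithinAt t (hv t ht.1))
    · exact min_zero_energy_le (hb0 t ht.1) (hc0 t ht.1) (hC (mem_image_of_mem _ ht))
        (hu' t ht.1) (hv' t ht.1)
  have h1 : min (u T) 0 = 0 := by nlinarith [sq_nonneg (min (u T) 0), sq_nonneg (min (v T) 0)]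
  have h2 : min (v T) 0 = 0 := by nlinarith [sq_nonneg (min (u T) 0), sq_nonneg (min (v T) 0)]
  exact ⟨min_eq_right_iff.1 h1, min_eq_right_iff.1 h2⟩

/-- A solution of `w' = w (1 - w) g` with continuous `g` that starts in `[0,1]` stays there. -/
lemma mem_Icc_of_hasDerivWithinAt_logistic {w g : ℝ → ℝ} (hg : ContinuousOn g (Ici 0))
    (hw : ∀ t ∈ Ici (0 : ℝ), HasDerivWithinAt w (w t * (1 - w t) * g t) (Ici 0) t)
    (h0 : w 0 ∈ Icc (0 : ℝ) 1) : ∀ t ∈ Ici (0 : ℝ), w t ∈ Icc (0 : ℝ) 1 := by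
  have hcont : ContinuousOn w (Ici 0) := fun t ht => (hw t ht).continuousWithinAt
  have h := nonneg_of_cooperative (a := fun t => (1 - w t) * g t) (b := fun _ => 0)
    (c := fun _ => 0) (d := fun t => -(w t * g t)) (v := fun t => 1 - w t)
    (by fun_prop) (by fun_prop) (by fun_prop) (by fun_prop) (fun _ _ => le_rfl)
    (fun _ _ => le_rfl) hw (fun t ht => (hw t ht).const_sub 1)
    (fun t _ => le_of_eq (by ring)) (fun t _ => le_of_eq (by ring)) h0.1 (sub_nonneg.2 h0.2)
  exact fun t ht => ⟨(h t ht).1, sub_nonneg.1 (h t ht).2⟩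

/-- Monotonicity in the AI skill parameter: for two copies of the coupled
skill–delegation ODE with AI skills `θa ≥ θ̂a`, started at the same initial
condition in `[0,1]²`, the skill is pointwise smaller and the delegation
pointwise larger under the stronger AI. -/
theorem coupled_ode_monotone_in_ai_skill
    (κ Δ : ℝ) (hκ : 0 < κ) (hΔ : 0 < Δ)
    (θa θah : ℝ) (hθa : θa ∈ Ioo (0:ℝ) 1) (hθah : θah ∈ Ioo (0:ℝ) 1)
    (hle : θah ≤ θa)
    (θ0 p0 : ℝ) (h0 : (θ0, p0) ∈ Icc (0:ℝ) 1 ×ˢ Icc (0:ℝ) 1)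
    (θ p θh ph : ℝ → ℝ)
    (hinit : θ 0 = θ0 ∧ p 0 = p0) (hinit' : θh 0 = θ0 ∧ ph 0 = p0)
    (hode : ∀ t ∈ Ici (0:ℝ),
      HasDerivWithinAt θ
        (θ t * (1 - θ t) * ((1 - p t) * (1 - θ t) - Δ * p t * θ t)) (Ici 0) t ∧
      HasDerivWithinAt p
        (κ * p t * (1 - p t) * ((1 - θ t) ^ 2 - (1 - θa) ^ 2)) (Ici 0) t)
    (hode' : ∀ t ∈ Ici (0:ℝ),
      HasDerivWithinAt θh
        (θh t * (1 - θh t) * ((1 - ph t) * (1 - θh t) - Δ * ph t * θh t)) (Ici 0) t ∧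
      HasDerivWithinAt ph
        (κ * ph t * (1 - ph t) * ((1 - θh t) ^ 2 - (1 - θah) ^ 2)) (Ici 0) t) :
    ∀ t ∈ Ici (0:ℝ), θ t ≤ θh t ∧ p t ≥ ph t := by
  obtain ⟨rfl, rfl⟩ := hinit
  have cθ : ContinuousOn θ (Ici 0) := fun t ht => (hode t ht).1.continuousWithinAt
  have cp : ContinuousOn p (Ici 0) := fun t ht => (hode t ht).2.continuousWithinAt
  have cθh : ContinuousOn θh (Ici 0) := fun t ht => (hode' t ht).1.continuousWithinAt
  have cph : ContinuousOn ph (Ici 0) := fun t ht => (hode' t ht).2.continuousWithinAt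
  have bθ : ∀ t ∈ Ici (0 : ℝ), θ t ∈ Icc (0 : ℝ) 1 :=
    mem_Icc_of_hasDerivWithinAt_logistic (by fun_prop) (fun t ht => (hode t ht).1) h0.1
  have bθh : ∀ t ∈ Ici (0 : ℝ), θh t ∈ Icc (0 : ℝ) 1 :=
    mem_Icc_of_hasDerivWithinAt_logistic (by fun_prop) (fun t ht => (hode' t ht).1)
      (hinit'.1 ▸ h0.1)
  have bph : ∀ t ∈ Ici (0 : ℝ), ph t ∈ Icc (0 : ℝ) 1 :=
    mem_Icc_of_hasDerivWithinAt_logistic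
      (g := fun t => κ * ((1 - θh t) ^ 2 - (1 - θah) ^ 2)) (by fun_prop)
      (fun t ht => (hode' t ht).2.congr_deriv (by ring)) (hinit'.2 ▸ h0.2)
  have hskill : 0 ≤ (1 - θah) ^ 2 - (1 - θa) ^ 2 := by
    nlinarith [hθa.2]
  have hlogistic : ∀ t ∈ Ici (0 : ℝ), 0 ≤ κ * ph t * (1 - ph t) := fun t ht =>
    mul_nonneg (mul_nonneg hκ.le (bph t ht).1) (sub_nonneg.2 (bph t ht).2)
  have h := nonneg_of_cooperative (u := fun t => θh t - θ t) (v := fun t => p t - ph t)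
    (a := fun t => (1 - ph t) *
        (1 - 2 * (θh t + θ t) + (θh t ^ 2 + θh t * θ t + θ t ^ 2)) -
      Δ * ph t * ((θh t + θ t) - (θh t ^ 2 + θh t * θ t + θ t ^ 2)))
    (b := fun t => θ t * (1 - θ t) * ((1 - θ t) + Δ * θ t))
    (c := fun t => κ * ph t * (1 - ph t) * ((1 - θ t) + (1 - θh t)))
    (d := fun t => κ * (1 - p t - ph t) * ((1 - θ t) ^ 2 - (1 - θa) ^ 2))
    (by fun_prop) (by fun_prop) (by fun_prop) (by fun_prop)
    (fun t ht => ?_) (fun t ht => ?_)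
    (fun t ht => (hode' t ht).1.sub (hode t ht).1) (fun t ht => (hode t ht).2.sub (hode' t ht).2)
    (fun t _ => le_of_eq (by ring)) (fun t ht => ?_) (by simp [hinit'.1]) (by simp [hinit'.2])
  · exact fun t ht => ⟨sub_nonneg.1 (h t ht).1, sub_nonneg.1 (h t ht).2⟩
  · obtain ⟨hl, hr⟩ := bθ t ht
    have := sub_nonneg.2 hr
    positivity
  · exact mul_nonneg (hlogistic t ht)
      (add_nonneg (sub_nonneg.2 (bθ t ht).2) (sub_nonneg.2 (bθh t ht).2))
  · linear_combination mul_nonneg (hlogistic t ht) hskill
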